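/- arXiv:0810.1382 — 2 statements merged into one kernel-verified Lean document; each statement's English description precedes it below -/
import Mathlib

section
/- Let f₂ = y² + (x+1)y + x² ∈ ℂ[x,y], let φ(u) = −u² + u³ − 2u⁴ + 4u⁵ − 9u⁶ + (111/4)u⁷ − (183/2)u⁸ + 316u⁹ − 1079u¹⁰ + (7259/2)u¹¹ − (801559/64)u¹² + (2872109/64)u¹³ − (5348333/32)u¹⁴, let h₁ = v + (4/9)u², and let J₇ = (u¹⁰, u⁴v, u²v², v³, uv·h₁) ⊆ ℂ[u,v]. Then the set of polynomials g ∈ ℂ[x,y] of total degree ≤ 4 such that g(u, v + φ(u)) ∈ J₇ is exactly the one-dimensional space ℂ·y²f₂. -/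
open MvPolynomial

noncomputable def u : MvPolynomial (Fin 2) ℂ := MvPolynomial.X 0
noncomputable def v : MvPolynomial (Fin 2) ℂ := MvPolynomial.X 1

/-- The conic `f₂ = y² + (x+1)y + x²` (in the variables `x = X 0`, `y = X 1`). -/
noncomputable def f₂ : MvPolynomial (Fin 2) ℂ := v ^ 2 + (u + 1) * v + u ^ 2

/-- The coordinate-change polynomial `φ(u)` of Remark 2. -/
noncomputable def phi : MvPolynomial (Fin 2) ℂ :=
  -u ^ 2 + u ^ 3 - 2 * u ^ 4 + 4 * u ^ 5 - 9 * u ^ 6 + C (111 / 4) * u ^ 7 -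
    C (183 / 2) * u ^ 8 + 316 * u ^ 9 - 1079 * u ^ 10 + C (7259 / 2) * u ^ 11 -
    C (801559 / 64) * u ^ 12 + C (2872109 / 64) * u ^ 13 - C (5348333 / 32) * u ^ 14

/-- The localization map `σ(g)(u,v) = g(u, v + φ(u))`. -/
noncomputable def σ (g : MvPolynomial (Fin 2) ℂ) : MvPolynomial (Fin 2) ℂ :=
  MvPolynomial.aeval ![u, v + phi] g

/-- `h₁ = v + (4/9)u²`. -/
noncomputable def h₁ : MvPolynomial (Fin 2) ℂ := v + C (4 / 9) * u ^ 2

/-- The adjunction ideal `J_{O,7,10} = (u¹⁰, u⁴v, u²v², v³, uv·h₁)`. -/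
noncomputable def J₇ : Ideal (MvPolynomial (Fin 2) ℂ) :=
  Ideal.span {u ^ 10, u ^ 4 * v, u ^ 2 * v ^ 2, v ^ 3, u * v * h₁}


/-- The sum of `J₇` and `(u⁹)`, which already determines the kernel in degree at most `4`. -/
noncomputable def truncatedIdeal : Ideal (MvPolynomial (Fin 2) ℂ) :=
  Ideal.span {u ^ 9, u ^ 4 * v, u ^ 2 * v ^ 2, v ^ 3, u * v * h₁}

lemma J₇_le_truncatedIdeal : J₇ ≤ truncatedIdeal := by
  refine Ideal.span_le.2 ?_
  have h : ∀ p ∈ ({u ^ 9, u ^ 4 * v, u ^ 2 * v ^ 2, v ^ 3, u * v * h₁} :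
      Set (MvPolynomial (Fin 2) ℂ)), p ∈ truncatedIdeal := fun p hp => Ideal.subset_span hp
  simp only [Set.mem_insert_iff, Set.mem_singleton_iff, forall_eq_or_imp, forall_eq] at h
  obtain ⟨h1, h2, h3, h4, h5⟩ := h
  rintro p (rfl | rfl | rfl | rfl | rfl)
  · rw [pow_succ]
    exact Ideal.mul_mem_right _ _ h1
  exacts [h2, h3, h4, h5]

/-- The exponent of the monomial `uⁱvʲ`. -/
noncomputable def bidegree (i j : ℕ) : Fin 2 →₀ ℕ := Finsupp.single 0 i + Finsupp.single 1 j

@[simp] lemma bidegree_zero (i j : ℕ) : bidegree i j 0 = i := by simp [bidegree]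

@[simp] lemma bidegree_one (i j : ℕ) : bidegree i j 1 = j := by simp [bidegree]

lemma bidegree_apply_eq (d : Fin 2 →₀ ℕ) : bidegree (d 0) (d 1) = d := by
  ext k
  fin_cases k <;> simp

lemma bidegree_le_bidegree {i j k l : ℕ} : bidegree i j ≤ bidegree k l ↔ i ≤ k ∧ j ≤ l := by
  simp [Finsupp.le_def, Fin.forall_fin_two]

lemma bidegree_inj {i j k l : ℕ} : bidegree i j = bidegree k l ↔ i = k ∧ j = l := by
  simp [Finsupp.ext_iff, Fin.forall_fin_two]

lemma bidegree_sub (i j k l : ℕ) :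
    bidegree i j - bidegree k l = bidegree (i - k) (j - l) := by
  ext t
  fin_cases t <;> simp

lemma u_pow_mul_v_pow (i j : ℕ) : u ^ i * v ^ j = monomial (bidegree i j) 1 := by
  simp [u, v, X_pow_eq_monomial, monomial_mul, bidegree]

lemma coeff_C_mul_u_pow_mul_v_pow (r : ℂ) (i j k l : ℕ) :
    coeff (bidegree k l) (C r * (u ^ i * v ^ j)) = if i = k ∧ j = l then r else 0 := by
  rw [u_pow_mul_v_pow, coeff_C_mul, coeff_monomial]
  simp [bidegree_inj]

lemma coeff_mul_u_pow_mul_v_pow (p : MvPolynomial (Fin 2) ℂ) (i j k l : ℕ) :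
    coeff (bidegree k l) (p * (u ^ i * v ^ j)) =
      if i ≤ k ∧ j ≤ l then coeff (bidegree (k - i) (l - j)) p else 0 := by
  rw [u_pow_mul_v_pow, coeff_mul_monomial']
  simp [bidegree_le_bidegree, bidegree_sub]

lemma exists_of_mem_truncatedIdeal {p : MvPolynomial (Fin 2) ℂ} (hp : p ∈ truncatedIdeal) :
    ∃ a b c d e : MvPolynomial (Fin 2) ℂ,
      p = a * (u ^ 9 * v ^ 0) + b * (u ^ 4 * v ^ 1) + c * (u ^ 2 * v ^ 2) + d * (u ^ 0 * v ^ 3) +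
        (e * (u ^ 1 * v ^ 2) + C (4 / 9) * (e * (u ^ 3 * v ^ 1))) := by
  simp only [truncatedIdeal, Ideal.mem_span_insert, Ideal.mem_span_singleton'] at hp
  obtain ⟨a, _, ⟨b, _, ⟨c, _, ⟨d, _, ⟨e, rfl⟩, rfl⟩, rfl⟩, rfl⟩, rfl⟩ := hp
  refine ⟨a, b, c, d, e, ?_⟩
  rw [h₁]
  ring

/-- The linear functionals cutting out `truncatedIdeal`. -/
lemma coeff_of_mem_truncatedIdeal {p : MvPolynomial (Fin 2) ℂ} (hp : p ∈ truncatedIdeal) :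
    (∀ i < 9, coeff (bidegree i 0) p = 0) ∧ (∀ i < 3, coeff (bidegree i 1) p = 0) ∧
      coeff (bidegree 0 2) p = 0 ∧
      coeff (bidegree 3 1) p = 4 / 9 * coeff (bidegree 1 2) p := by
  obtain ⟨a, b, c, d, e, rfl⟩ := exists_of_mem_truncatedIdeal hp
  simp only [coeff_add, coeff_C_mul, coeff_mul_u_pow_mul_v_pow]
  refine ⟨fun i hi => ?_, fun i hi => ?_, ?_, ?_⟩
  · simp [hi.not_ge]
  · have h4 : ¬ 4 ≤ i := by lia
    have h9 : ¬ 9 ≤ i := by lia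
    simp [hi.not_ge, h4, h9]
  · simp
  · simp

lemma eq_sum_of_totalDegree_le_four {g : MvPolynomial (Fin 2) ℂ} (hg : g.totalDegree ≤ 4) :
    g = ∑ i ∈ Finset.range 5, ∑ j ∈ Finset.range (5 - i),
      C (coeff (bidegree i j) g) * (u ^ i * v ^ j) := by
  ext d
  rw [← bidegree_apply_eq d]
  generalize d 0 = k, d 1 = l
  by_cases h : k + l ≤ 4
  · simp only [coeff_sum, coeff_C_mul_u_pow_mul_v_pow]
    rw [Finset.sum_eq_single k, Finset.sum_eq_single l]
    · simp
    · intro j _ hj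
      simp [hj]
    · intro hl
      simp at hl
      lia
    · intro i _ hi
      simp [hi]
    · intro hk
      simp at hk
      lia
  · rw [coeff_eq_zero_of_totalDegree_lt, coeff_sum, Finset.sum_eq_zero]
    · intro i hi
      rw [coeff_sum, Finset.sum_eq_zero]
      intro j hj
      rw [coeff_C_mul_u_pow_mul_v_pow, if_neg]
      simp at hi hj
      lia
    · refine hg.trans_lt ?_
      rw [← Finsupp.degree_apply, Finsupp.degree_eq_sum, Fin.sum_univ_two]
      simp
      lia

lemma exists_phi_eq : ∃ q, phi = -u ^ 2 + u ^ 3 - 2 * u ^ 4 + 4 * u ^ 5 - 9 * u ^ 6 +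
    C (111 / 4) * u ^ 7 - C (183 / 2) * u ^ 8 + u ^ 9 * q := by
  refine ⟨316 - 1079 * u + C (7259 / 2) * u ^ 2 - C (801559 / 64) * u ^ 3 +
    C (2872109 / 64) * u ^ 4 - C (5348333 / 32) * u ^ 5, ?_⟩
  rw [phi]
  ring

section NormalForms

variable {A : Type*} [CommRing A] {U V Y q : A}

lemma sq_mul_conic_eq_zero (h1 : U ^ 10 = 0) (h2 : U ^ 4 * V = 0) (h3 : U ^ 2 * V ^ 2 = 0)
    (h4 : V ^ 3 = 0) (hY : Y = V + (-U ^ 2 + U ^ 3 - 2 * U ^ 4 + 4 * U ^ 5 + U ^ 6 * q)) :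
    Y ^ 2 * (Y ^ 2 + (U + 1) * Y + U ^ 2) = 0 := by
  subst hY
  grind

lemma sq_normal_form (h1 : U ^ 9 = 0) (h2 : U ^ 4 * V = 0)
    (hY : Y = V + (-U ^ 2 + U ^ 3 - 2 * U ^ 4 + 4 * U ^ 5 - 9 * U ^ 6 + U ^ 7 * q)) :
    Y ^ 2 = V ^ 2 - 2 * (U ^ 2 * V) + 2 * (U ^ 3 * V) + U ^ 4 - 2 * U ^ 5 + 5 * U ^ 6
      - 12 * U ^ 7 + 30 * U ^ 8 := by
  subst hY
  grind

lemma cube_normal_form (h1 : U ^ 9 = 0) (h2 : U ^ 4 * V = 0) (h3 : U ^ 2 * V ^ 2 = 0)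
    (h4 : V ^ 3 = 0) (hY : Y = V + (-U ^ 2 + U ^ 3 - 2 * U ^ 4 + U ^ 5 * q)) :
    Y ^ 3 = -U ^ 6 + 3 * U ^ 7 - 9 * U ^ 8 := by
  subst hY
  grind

lemma fourth_normal_form (h1 : U ^ 9 = 0) (h2 : U ^ 4 * V = 0) (h3 : U ^ 2 * V ^ 2 = 0)
    (h4 : V ^ 3 = 0) (hY : Y = V + (-U ^ 2 + U ^ 3 * q)) : Y ^ 4 = U ^ 8 := by
  subst hY
  grind

end NormalForms

lemma sq_mul_conic_eq : v ^ 2 * f₂ = C 1 * (u ^ 0 * v ^ 4) + C 1 * (u ^ 1 * v ^ 3) +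
    C 1 * (u ^ 0 * v ^ 3) + C 1 * (u ^ 2 * v ^ 2) := by
  rw [f₂, C_1]
  ring

lemma sq_mul_conic_ne_zero : v ^ 2 * f₂ ≠ 0 := by
  intro h
  have := congrArg (coeff (bidegree 0 4)) h
  simp only [sq_mul_conic_eq, coeff_add, coeff_C_mul_u_pow_mul_v_pow] at this
  simp at this

lemma totalDegree_sq_mul_conic_le : (v ^ 2 * f₂).totalDegree ≤ 4 := by
  have h : ∀ i j, i + j ≤ 4 → (C 1 * (u ^ i * v ^ j)).totalDegree ≤ 4 := by
    intro i j hij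
    rw [C_1, one_mul, u, v]
    refine (totalDegree_mul _ _).trans ?_
    simpa using hij
  rw [sq_mul_conic_eq]
  refine (totalDegree_add _ _).trans (max_le ((totalDegree_add _ _).trans
    (max_le ((totalDegree_add _ _).trans (max_le ?_ ?_)) ?_)) ?_) <;> exact h _ _ (by norm_num)

/-- Sufficiency: `y² f₂` lies in the kernel of the localization map. -/
lemma σ_sq_mul_conic_mem : σ (v ^ 2 * f₂) ∈ J₇ := by
  have hs : ∀ p ∈ ({u ^ 10, u ^ 4 * v, u ^ 2 * v ^ 2, v ^ 3, u * v * h₁} :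
      Set (MvPolynomial (Fin 2) ℂ)), Ideal.Quotient.mk J₇ p = 0 :=
    fun p hp => Ideal.Quotient.eq_zero_iff_mem.2 (Ideal.subset_span hp)
  simp only [Set.mem_insert_iff, Set.mem_singleton_iff, forall_eq_or_imp, forall_eq,
    map_mul, map_pow] at hs
  obtain ⟨h1, h2, h3, h4, -⟩ := hs
  obtain ⟨q, hq⟩ := exists_phi_eq
  have hσ : σ (v ^ 2 * f₂) = (v + phi) ^ 2 * ((v + phi) ^ 2 + (u + 1) * (v + phi) + u ^ 2) := by
    simp [σ, f₂, u, v]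
  rw [← Ideal.Quotient.eq_zero_iff_mem, hσ]
  simp only [map_mul, map_pow, map_add, map_one]
  rw [← map_add (Ideal.Quotient.mk J₇) v phi]
  refine sq_mul_conic_eq_zero h1 h2 h3 h4
    (q := Ideal.Quotient.mk J₇ (-9 + C (111 / 4) * u - C (183 / 2) * u ^ 2 + u ^ 3 * q)) ?_
  rw [hq]
  simp only [map_mul, map_pow, map_add, map_sub, map_neg, map_ofNat]
  ring

/-- The image of a quartic under the localization map, modulo `truncatedIdeal`. -/
lemma σ_sub_mem_truncatedIdeal (c : ℕ → ℕ → ℂ) :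
    σ (∑ i ∈ Finset.range 5, ∑ j ∈ Finset.range (5 - i), C (c i j) * (u ^ i * v ^ j)) -
      (C (c 0 0) * (u ^ 0 * v ^ 0) + C (c 1 0) * (u ^ 1 * v ^ 0) +
        C (c 2 0 - c 0 1) * (u ^ 2 * v ^ 0) +
        C (c 3 0 + c 0 1 - c 1 1) * (u ^ 3 * v ^ 0) +
        C (c 4 0 - 2 * c 0 1 + c 1 1 - c 2 1 + c 0 2) * (u ^ 4 * v ^ 0) +
        C (4 * c 0 1 - 2 * c 1 1 + c 2 1 - c 3 1 - 2 * c 0 2 + c 1 2) * (u ^ 5 * v ^ 0) +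
        C (-9 * c 0 1 + 4 * c 1 1 - 2 * c 2 1 + c 3 1 + 5 * c 0 2 - 2 * c 1 2 + c 2 2 - c 0 3) *
          (u ^ 6 * v ^ 0) +
        C (111 / 4 * c 0 1 - 9 * c 1 1 + 4 * c 2 1 - 2 * c 3 1 - 12 * c 0 2 + 5 * c 1 2 -
          2 * c 2 2 + 3 * c 0 3 - c 1 3) * (u ^ 7 * v ^ 0) +
        C (-(183 / 2) * c 0 1 + 111 / 4 * c 1 1 - 9 * c 2 1 + 4 * c 3 1 + 30 * c 0 2 -
          12 * c 1 2 + 5 * c 2 2 - 9 * c 0 3 + 3 * c 1 3 + c 0 4) * (u ^ 8 * v ^ 0) +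
        C (c 0 1) * (u ^ 0 * v ^ 1) + C (c 1 1) * (u ^ 1 * v ^ 1) +
        C (c 2 1 - 2 * c 0 2) * (u ^ 2 * v ^ 1) +
        C (c 3 1 + 2 * c 0 2 - 2 * c 1 2) * (u ^ 3 * v ^ 1) +
        C (c 0 2) * (u ^ 0 * v ^ 2) + C (c 1 2) * (u ^ 1 * v ^ 2)) ∈ truncatedIdeal := by
  have hs : ∀ p ∈ ({u ^ 9, u ^ 4 * v, u ^ 2 * v ^ 2, v ^ 3, u * v * h₁} :
      Set (MvPolynomial (Fin 2) ℂ)), Ideal.Quotient.mk truncatedIdeal p = 0 :=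
    fun p hp => Ideal.Quotient.eq_zero_iff_mem.2 (Ideal.subset_span hp)
  simp only [Set.mem_insert_iff, Set.mem_singleton_iff, forall_eq_or_imp, forall_eq,
    map_mul, map_pow] at hs
  obtain ⟨h1, h2, h3, h4, -⟩ := hs
  obtain ⟨q, hq⟩ := exists_phi_eq
  have hσ : σ (∑ i ∈ Finset.range 5, ∑ j ∈ Finset.range (5 - i), C (c i j) * (u ^ i * v ^ j)) =
      ∑ i ∈ Finset.range 5, ∑ j ∈ Finset.range (5 - i),
        C (c i j) * (u ^ i * (v + phi) ^ j) := by
    simp [σ, u, v, algebraMap_eq]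
  rw [← Ideal.Quotient.eq_zero_iff_mem, hσ]
  have hY := congrArg (fun p => Ideal.Quotient.mk truncatedIdeal (v + p)) hq
  simp only [map_mul, map_pow, map_add, map_sub, map_neg, map_ofNat] at hY
  generalize hy : v + phi = y
  rw [← map_add, hy] at hY
  simp only [Finset.sum_range_succ, Finset.sum_range_zero, map_mul, map_pow, map_add, map_sub,
    map_neg, map_ofNat, map_zero]
  generalize hk : (fun i j => Ideal.Quotient.mk truncatedIdeal (C (c i j))) = k
  have hk' : ∀ i j, Ideal.Quotient.mk truncatedIdeal (C (c i j)) = k i j :=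
    fun i j => by rw [← hk]
  simp only [hk']
  generalize Ideal.Quotient.mk truncatedIdeal u = U, Ideal.Quotient.mk truncatedIdeal v = V,
    Ideal.Quotient.mk truncatedIdeal y = Y, Ideal.Quotient.mk truncatedIdeal q = Q,
    Ideal.Quotient.mk truncatedIdeal (C (111 / 4)) = a,
    Ideal.Quotient.mk truncatedIdeal (C (183 / 2)) = b at *
  have y2 := sq_normal_form h1 h2
    (q := a - b * U + U ^ 2 * Q) (hY.trans (by ring))
  have y3 := cube_normal_form h1 h2 h3 h4
    (q := 4 - 9 * U + a * U ^ 2 - b * U ^ 3 + U ^ 4 * Q) (hY.trans (by ring))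
  have y4 := fourth_normal_form h1 h2 h3 h4
    (q := 1 - 2 * U + 4 * U ^ 2 - 9 * U ^ 3 + a * U ^ 4 - b * U ^ 5 + U ^ 6 * Q)
    (hY.trans (by ring))
  have z01 : Y = V - U ^ 2 + U ^ 3 - 2 * U ^ 4 + 4 * U ^ 5 - 9 * U ^ 6 + a * U ^ 7 -
      b * U ^ 8 := by
    linear_combination hY + Q * h1
  have z11 : U * Y = U * V - U ^ 3 + U ^ 4 - 2 * U ^ 5 + 4 * U ^ 6 - 9 * U ^ 7 + a * U ^ 8 := by
    linear_combination U * z01 - b * h1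
  have z21 : U ^ 2 * Y = U ^ 2 * V - U ^ 4 + U ^ 5 - 2 * U ^ 6 + 4 * U ^ 7 - 9 * U ^ 8 := by
    linear_combination U * z11 + a * h1
  have z31 : U ^ 3 * Y = U ^ 3 * V - U ^ 5 + U ^ 6 - 2 * U ^ 7 + 4 * U ^ 8 := by
    linear_combination U * z21 - 9 * h1
  have z12 : U * Y ^ 2 = U * V ^ 2 - 2 * (U ^ 3 * V) + U ^ 5 - 2 * U ^ 6 + 5 * U ^ 7
      - 12 * U ^ 8 := by
    linear_combination U * y2 + 2 * h2 + 30 * h1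
  have z22 : U ^ 2 * Y ^ 2 = U ^ 6 - 2 * U ^ 7 + 5 * U ^ 8 := by
    linear_combination U * z12 + h3 - 2 * h2 - 12 * h1
  have z13 : U * Y ^ 3 = -U ^ 7 + 3 * U ^ 8 := by
    linear_combination U * y3 - 9 * h1
  linear_combination k 0 1 * z01 + k 1 1 * z11 + k 2 1 * z21 + k 3 1 * z31 + k 0 2 * y2 +
    k 1 2 * z12 + k 2 2 * z22 + k 0 3 * y3 + k 1 3 * z13 + k 0 4 * y4

/-- Necessity: a quartic in the kernel of the localization map is a multiple of `y² f₂`. -/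
lemma eq_smul_sq_mul_conic_of_mem {g : MvPolynomial (Fin 2) ℂ} (hg : g.totalDegree ≤ 4)
    (hσ : σ g ∈ J₇) : g = coeff (bidegree 0 4) g • (v ^ 2 * f₂) := by
  have hsum := eq_sum_of_totalDegree_le_four hg
  generalize hc : (fun i j => coeff (bidegree i j) g) = c
  have hc' : ∀ i j, coeff (bidegree i j) g = c i j := fun i j => by rw [← hc]
  simp only [hc'] at hsum ⊢
  have hR := sub_mem (J₇_le_truncatedIdeal hσ)
    (hsum ▸ σ_sub_mem_truncatedIdeal c)
  rw [sub_sub_cancel] at hR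
  obtain ⟨hu, huv, hv, hw⟩ := coeff_of_mem_truncatedIdeal hR
  simp only [coeff_add, coeff_C_mul_u_pow_mul_v_pow] at hu huv hv hw
  have e0 := hu 0
  have e1 := hu 1
  have e2 := hu 2
  have e3 := hu 3
  have e4 := hu 4
  have e5 := hu 5
  have e6 := hu 6
  have e7 := hu 7
  have e8 := hu 8
  have f0 := huv 0
  have f1 := huv 1
  have f2 := huv 2
  clear hu huv
  norm_num at e0 e1 e2 e3 e4 e5 e6 e7 e8 f0 f1 f2 hv hw
  simp only [f0, f1, hv] at e2 e3 e4 e5 e6 e7 e8 f2 hw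
  have g21 : c 2 1 = 0 := by linear_combination f2
  have g12 : c 1 2 = 0 := by linear_combination -9 / 13 * e5 - 9 / 13 * hw + 9 / 13 * g21
  have g31 : c 3 1 = 0 := by linear_combination hw + 22 / 9 * g12
  have g20 : c 2 0 = 0 := by linear_combination e2
  have g30 : c 3 0 = 0 := by linear_combination e3
  have g40 : c 4 0 = 0 := by linear_combination e4 + g21
  have g22 : c 2 2 = c 0 3 := by linear_combination e6 + 2 * g21 - g31 + 2 * g12
  have g13 : c 1 3 = c 0 3 := by
    linear_combination -e7 + 4 * g21 - 2 * g31 + 5 * g12 - 2 * g22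
  have g03 : c 0 3 = c 0 4 := by
    linear_combination -e8 - 9 * g21 + 4 * g31 - 12 * g12 + 5 * g22 + 3 * g13
  rw [g03] at g22 g13
  rw [hsum, sq_mul_conic_eq, smul_eq_C_mul, C_1]
  simp only [Finset.sum_range_succ, Finset.sum_range_zero, e0, e1, f0, f1, hv, g21, g12, g31, g20,
    g30, g40, g22, g13, g03, C_0]
  ring

/-- Case `k = 7` of Assertion 3(b): `Ker σ̄₇` is the one-dimensional space `ℂ·y²f₂`. -/
theorem ker_sigma_seven :
    {g : MvPolynomial (Fin 2) ℂ | g.totalDegree ≤ 4 ∧ σ g ∈ J₇} =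
      ↑(Submodule.span ℂ {v ^ 2 * f₂}) ∧
    Module.finrank ℂ ↥(Submodule.span ℂ ({v ^ 2 * f₂} :
      Set (MvPolynomial (Fin 2) ℂ))) = 1 := by
  refine ⟨?_, finrank_span_singleton ?_⟩
  · ext g
    rw [Set.mem_ofPred_eq, SetLike.mem_coe, Submodule.mem_span_singleton]
    constructor
    · rintro ⟨hg, hσ⟩
      exact ⟨_, (eq_smul_sq_mul_conic_of_mem hg hσ).symm⟩
    · rintro ⟨a, rfl⟩
      refine ⟨(totalDegree_smul_le _ _).trans totalDegree_sq_mul_conic_le, ?_⟩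
      have : σ (a • (v ^ 2 * f₂)) = C a * σ (v ^ 2 * f₂) := by
        rw [σ, map_smul, smul_eq_C_mul, σ]
      rw [this]
      exact Ideal.mul_mem_left _ _ σ_sq_mul_conic_mem
  · exact sq_mul_conic_ne_zero
end

section
/- Let f₂ = y² + (x+1)y + x² and f₅ = y⁵ + xy⁴ + 2(x²+x)y³ + ((85/27)x³ + 2x² + x)y² + ((58/27)x⁴ + (58/27)x³)y + (31/27)x⁵ in ℂ[x,y], let φ(u) = −u² + u³ − 2u⁴ + 4u⁵ − 9u⁶ + (111/4)u⁷ − (183/2)u⁸ + 316u⁹ − 1079u¹⁰ + (7259/2)u¹¹ − (801559/64)u¹² + (2872109/64)u¹³ − (5348333/32)u¹⁴, let h₁ = v + (4/9)u², r₁ = v + (4/9)u² − (13/9)u³, and let J₉ = (u¹⁷, u⁷v, u⁵v², u³v³, uv⁴, v⁵, u³v·r₁, uv²·r₁, v³·h₁) ⊆ ℂ[u,v]. Then the set of polynomials g ∈ ℂ[x,y] of total degree ≤ 6 such that g(u, v + φ(u)) ∈ J₉ is exactly the one-dimensional space ℂ·p, where p = 3y·f₅ − 2xy·f₂² − (81/52)·y²·f₂².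 -/
open MvPolynomial

/-- The quintic `f₅` of Remark 2. -/
noncomputable def f₅ : MvPolynomial (Fin 2) ℂ :=
  v ^ 5 + u * v ^ 4 + 2 * (u ^ 2 + u) * v ^ 3 +
    (C (85 / 27) * u ^ 3 + 2 * u ^ 2 + u) * v ^ 2 +
    (C (58 / 27) * u ^ 4 + C (58 / 27) * u ^ 3) * v + C (31 / 27) * u ^ 5

/-- `r₁ = v + (4/9)u² - (13/9)u³`. -/
noncomputable def r₁ : MvPolynomial (Fin 2) ℂ :=
  v + C (4 / 9) * u ^ 2 - C (13 / 9) * u ^ 3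

/-- The adjunction ideal
`J_{O,9,10} = (u¹⁷, u⁷v, u⁵v², u³v³, uv⁴, v⁵, u³v·r₁, uv²·r₁, v³·h₁)`. -/
noncomputable def J₉ : Ideal (MvPolynomial (Fin 2) ℂ) :=
  Ideal.span {u ^ 17, u ^ 7 * v, u ^ 5 * v ^ 2, u ^ 3 * v ^ 3, u * v ^ 4, v ^ 5,
    u ^ 3 * v * r₁, u * v ^ 2 * r₁, v ^ 3 * h₁}

/-- The kernel generator `p = 3y f₅ − 2xy f₂² − (81/52) y² f₂²`. -/
noncomputable def p : MvPolynomial (Fin 2) ℂ :=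
  3 * v * f₅ - 2 * u * v * f₂ ^ 2 - C (81 / 52) * v ^ 2 * f₂ ^ 2

theorem σ_apply_monomial (c : ℂ) (i j : ℕ) :
    σ (C c * (u ^ i * v ^ j)) = C c * (u ^ i * (v + phi) ^ j) := by
  simp [σ, u, v, algebraMap_eq]

/-- The exponent vector of `u ^ a * v ^ b`. -/
noncomputable def expo (a b : ℕ) : Fin 2 →₀ ℕ := Finsupp.single 0 a + Finsupp.single 1 b

@[simp] theorem expo_zero (a b : ℕ) : expo a b 0 = a := by simp [expo]

@[simp] theorem expo_one (a b : ℕ) : expo a b 1 = b := by simp [expo]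

theorem expo_eta (m : Fin 2 →₀ ℕ) : expo (m 0) (m 1) = m := by
  ext i; fin_cases i <;> simp

theorem expo_inj {a b i j : ℕ} : expo a b = expo i j ↔ a = i ∧ b = j :=
  ⟨fun h => ⟨by simpa using DFunLike.congr_fun h 0, by simpa using DFunLike.congr_fun h 1⟩,
    by rintro ⟨rfl, rfl⟩; rfl⟩

theorem expo_le {a b i j : ℕ} : expo i j ≤ expo a b ↔ i ≤ a ∧ j ≤ b := by
  refine ⟨fun h => ⟨by simpa using h 0, by simpa using h 1⟩, fun h k => ?_⟩
  fin_cases k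
  · simpa using h.1
  · simpa using h.2

theorem expo_sub (a b i j : ℕ) : expo a b - expo i j = expo (a - i) (b - j) := by
  ext k; fin_cases k <;> simp

theorem monomial_expo (a b : ℕ) (r : ℂ) : monomial (expo a b) r = C r * (u ^ a * v ^ b) := by
  rw [monomial_eq, Finsupp.prod_fintype _ _ (by simp)]
  simp [u, v, Fin.prod_univ_two]

/-- The coefficient of `u ^ a * v ^ b`, as a linear form. -/
noncomputable def cf (a b : ℕ) : MvPolynomial (Fin 2) ℂ →ₗ[ℂ] ℂ := lcoeff ℂ (expo a b)

theorem cf_apply (a b : ℕ) (q : MvPolynomial (Fin 2) ℂ) : cf a b q = coeff (expo a b) q := rfl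

theorem cf_mul_monomial (a b i j : ℕ) (q : MvPolynomial (Fin 2) ℂ) :
    cf a b (q * (u ^ i * v ^ j)) = if i ≤ a ∧ j ≤ b then cf (a - i) (b - j) q else 0 := by
  have h : u ^ i * v ^ j = monomial (expo i j) 1 := by simp [monomial_expo]
  rw [h, cf_apply, coeff_mul_monomial', expo_sub]
  simp [expo_le, cf_apply]

theorem cf_C_mul (a b : ℕ) (r : ℂ) (q : MvPolynomial (Fin 2) ℂ) :
    cf a b (C r * q) = r * cf a b q := coeff_C_mul _ _ _

theorem cf_monomial (a b i j : ℕ) :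
    cf a b (u ^ i * v ^ j) = if i = a ∧ j = b then 1 else 0 := by
  rw [cf_apply, ← one_mul (u ^ i * v ^ j), ← C_1, ← monomial_expo, coeff_monomial]
  simp [expo_inj]

theorem eq_sum_of_totalDegree_le {g : MvPolynomial (Fin 2) ℂ} {n : ℕ} (hg : g.totalDegree ≤ n) :
    g = ∑ i ∈ Finset.range (n + 1), ∑ j ∈ Finset.range (n + 1 - i),
      C (cf i j g) * (u ^ i * v ^ j) := by
  ext m
  rw [← expo_eta m, ← cf_apply, ← cf_apply]
  generalize m 0 = a
  generalize m 1 = b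
  simp only [map_sum, cf_C_mul, cf_monomial, mul_ite, mul_one, mul_zero, ite_and,
    Finset.sum_ite_irrel, Finset.sum_const_zero, Finset.sum_ite_eq', Finset.mem_range]
  split_ifs with h₁ h₂
  · rfl
  all_goals
    refine coeff_eq_zero_of_totalDegree_lt (lt_of_le_of_lt hg ?_)
    rw [Finset.sum_subset (Finset.subset_univ _) (by simp), Fin.sum_univ_two, expo_zero, expo_one]
    omega

theorem totalDegree_sum_monomial_le (c : ℕ → ℕ → ℂ) (n : ℕ) :
    (∑ i ∈ Finset.range (n + 1), ∑ j ∈ Finset.range (n + 1 - i),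
      C (c i j) * (u ^ i * v ^ j)).totalDegree ≤ n := by
  refine totalDegree_finsetSum_le fun i hi => totalDegree_finsetSum_le fun j hj => ?_
  simp only [Finset.mem_range] at hi hj
  rw [← monomial_expo]
  refine (totalDegree_monomial_le _ _).trans ?_
  rw [Finsupp.sum_fintype _ _ (by simp), Fin.sum_univ_two, expo_zero, expo_one]
  simp only [id]
  omega

/-- The linear form on `ℂ[u, v] / J₉` dual to `u⁵v`, when `1, …, u¹⁶`, `v, …, u⁶v`,
`v²`, `uv²`, `u²v²`, `v³` is taken as the basis. -/
noncomputable def cfFive : MvPolynomial (Fin 2) ℂ →ₗ[ℂ] ℂ :=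
  cf 5 1 - (4 / 9 : ℂ) • cf 3 2 + (16 / 81 : ℂ) • cf 1 3

/-- The linear form dual to `u⁶v` in the basis described at `cfFive`. -/
noncomputable def cfSix : MvPolynomial (Fin 2) ℂ →ₗ[ℂ] ℂ :=
  cf 6 1 + (13 / 9 : ℂ) • cf 3 2 - (4 / 9 : ℂ) • cf 4 2 - (104 / 81 : ℂ) • cf 1 3
    + (16 / 81 : ℂ) • cf 2 3 - (64 / 729 : ℂ) • cf 0 4

/-- The normal form modulo `J₉`. -/
noncomputable def normalForm (q : MvPolynomial (Fin 2) ℂ) : MvPolynomial (Fin 2) ℂ :=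
  ∑ a ∈ Finset.range 17, C (cf a 0 q) * (u ^ a * v ^ 0)
    + ∑ a ∈ Finset.range 5, C (cf a 1 q) * (u ^ a * v ^ 1)
    + ∑ a ∈ Finset.range 3, C (cf a 2 q) * (u ^ a * v ^ 2)
    + C (cf 0 3 q) * (u ^ 0 * v ^ 3)
    + C (cfFive q) * (u ^ 5 * v ^ 1) + C (cfSix q) * (u ^ 6 * v ^ 1)

theorem normalForm_add (q r : MvPolynomial (Fin 2) ℂ) :
    normalForm (q + r) = normalForm q + normalForm r := by
  simp only [normalForm, map_add, add_mul, Finset.sum_add_distrib]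
  ring

theorem normalForm_C_mul (r : ℂ) (q : MvPolynomial (Fin 2) ℂ) :
    normalForm (C r * q) = C r * normalForm q := by
  simp only [normalForm, cfFive, cfSix, LinearMap.add_apply, LinearMap.sub_apply,
    LinearMap.smul_apply, smul_eq_mul, cf_C_mul, map_mul, map_add, map_sub, mul_add,
    Finset.mul_sum, mul_assoc]
  ring

theorem monomial_mem_J₉ {i j a b : ℕ} (h : u ^ i * v ^ j ∈ J₉) (hi : i ≤ a) (hj : j ≤ b) :
    u ^ a * v ^ b ∈ J₉ :=
  J₉.mem_of_dvd (mul_dvd_mul (pow_dvd_pow u hi) (pow_dvd_pow v hj)) h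

theorem generators_mem_J₉ :
    u ^ 17 * v ^ 0 ∈ J₉ ∧ u ^ 7 * v ^ 1 ∈ J₉ ∧ u ^ 5 * v ^ 2 ∈ J₉ ∧ u ^ 3 * v ^ 3 ∈ J₉ ∧
      u ^ 1 * v ^ 4 ∈ J₉ ∧ u ^ 0 * v ^ 5 ∈ J₉ ∧ u ^ 3 * v * r₁ ∈ J₉ ∧ u * v ^ 2 * r₁ ∈ J₉ ∧
      v ^ 3 * h₁ ∈ J₉ := by
  simp only [pow_zero, mul_one, one_mul, pow_one]
  refine ⟨?_, ?_, ?_, ?_, ?_, ?_, ?_, ?_, ?_⟩ <;> exact Ideal.subset_span (by simp)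

theorem sub_normalForm_mem_J₉ (q : MvPolynomial (Fin 2) ℂ) : q - normalForm q ∈ J₉ := by
  obtain ⟨h17, h7, h5, h3, h1, h0, hr3, hr1, hv⟩ := generators_mem_J₉
  induction q using MvPolynomial.induction_on' with
  | add q r hq hr =>
    rw [normalForm_add, add_sub_add_comm]
    exact J₉.add_mem hq hr
  | monomial m r =>
    rw [← expo_eta m, monomial_expo, normalForm_C_mul, ← mul_sub]
    refine J₉.mul_mem_left _ ?_
    generalize m 0 = a
    generalize m 1 = b
    by_cases hmem : 17 ≤ a ∨ 7 ≤ a ∧ 1 ≤ b ∨ 5 ≤ a ∧ 2 ≤ b ∨ 3 ≤ a ∧ 3 ≤ b ∨ 1 ≤ a ∧ 4 ≤ b ∨ 5 ≤ b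
    · have hzero : normalForm (u ^ a * v ^ b) = 0 := by
        have hne : ∀ i j : ℕ, ¬ (17 ≤ i ∨ 7 ≤ i ∧ 1 ≤ j ∨ 5 ≤ i ∧ 2 ≤ j ∨ 3 ≤ i ∧ 3 ≤ j ∨
            1 ≤ i ∧ 4 ≤ j ∨ 5 ≤ j) → cf i j (u ^ a * v ^ b) = 0 := by
          intro i j hij
          rw [cf_monomial, if_neg]
          rintro ⟨rfl, rfl⟩
          exact hij hmem
        simp [normalForm, cfFive, cfSix, Finset.sum_range_succ, hne]
      rw [hzero, sub_zero]
      rcases hmem with h | h | h | h | h | h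
      · exact monomial_mem_J₉ h17 h b.zero_le
      · exact monomial_mem_J₉ h7 h.1 h.2
      · exact monomial_mem_J₉ h5 h.1 h.2
      · exact monomial_mem_J₉ h3 h.1 h.2
      · exact monomial_mem_J₉ h1 h.1 h.2
      · exact monomial_mem_J₉ h0 a.zero_le h
    · have h42 : u ^ 4 * v ^ 2 + C (4 / 9) * (u ^ 6 * v ^ 1) ∈ J₉ := by
        convert J₉.add_mem (J₉.mul_mem_left u hr3) (J₉.mul_mem_left (C (13 / 9)) h7) using 1
        simp only [r₁]; ring
      have h23 : u ^ 2 * v ^ 3 - C (16 / 81) * (u ^ 6 * v ^ 1) ∈ J₉ := by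
        convert J₉.add_mem (J₉.sub_mem (J₉.mul_mem_left u hr1) (J₉.mul_mem_left (C (4 / 9)) h42))
          (J₉.mul_mem_left (C (13 / 9)) h5) using 1
        refine MvPolynomial.funext fun x => ?_
        simp [r₁]; ring
      have h13 : u ^ 1 * v ^ 3 - (C (16 / 81) * (u ^ 5 * v ^ 1) -
          C (104 / 81) * (u ^ 6 * v ^ 1)) ∈ J₉ := by
        convert J₉.add_mem (J₉.sub_mem hr1 (J₉.mul_mem_left (C (4 / 9)) hr3))
          (J₉.mul_mem_left (C (13 / 9)) h42) using 1
        refine MvPolynomial.funext fun x => ?_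
        simp [r₁]; ring
      have h04 : u ^ 0 * v ^ 4 + C (64 / 729) * (u ^ 6 * v ^ 1) ∈ J₉ := by
        convert J₉.sub_mem hv (J₉.mul_mem_left (C (4 / 9)) h23) using 1
        refine MvPolynomial.funext fun x => ?_
        simp [h₁]; ring
      have hb : b = 0 ∨ b = 1 ∨ b = 2 ∨ b = 3 ∨ b = 4 := by omega
      simp only [normalForm, cfFive, cfSix, LinearMap.add_apply, LinearMap.sub_apply,
        LinearMap.smul_apply, smul_eq_mul, cf_monomial]
      rcases hb with rfl | rfl | rfl | rfl | rfl
      · have ha : a < 17 := by omega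
        simp [ha]
      · have ha : a < 7 := by omega
        interval_cases a <;> simp
      · have ha : a < 5 := by omega
        interval_cases a
        · simp
        · simp
        · simp
        · convert hr3 using 1
          simp [r₁]; ring
        · simpa using h42
      · have ha : a < 3 := by omega
        interval_cases a
        · simp
        · convert h13 using 1
          simp; ring
        · simpa using h23
      · have ha : a = 0 := by omega
        subst ha
        simpa using h04

theorem mem_J₉_iff (q : MvPolynomial (Fin 2) ℂ) :
    q ∈ J₉ ↔ (∀ a < 17, cf a 0 q = 0) ∧ (∀ a < 5, cf a 1 q = 0) ∧ (∀ a < 3, cf a 2 q = 0) ∧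
      cf 0 3 q = 0 ∧ cfFive q = 0 ∧ cfSix q = 0 := by
  constructor
  · intro hq
    have key : ∀ q₁ q₂ q₃ q₄ q₅ q₆ q₇ q₈ q₉ : MvPolynomial (Fin 2) ℂ,
        q = q₁ * (u ^ 17 * v ^ 0) + q₂ * (u ^ 7 * v ^ 1) + q₃ * (u ^ 5 * v ^ 2)
          + q₄ * (u ^ 3 * v ^ 3) + q₅ * (u ^ 1 * v ^ 4) + q₆ * (u ^ 0 * v ^ 5)
          + q₇ * (u ^ 3 * v * r₁) + q₈ * (u * v ^ 2 * r₁) + q₉ * (v ^ 3 * h₁) →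
        (∀ a < 17, cf a 0 q = 0) ∧ (∀ a < 5, cf a 1 q = 0) ∧ (∀ a < 3, cf a 2 q = 0) ∧
          cf 0 3 q = 0 ∧ cfFive q = 0 ∧ cfSix q = 0 := by
      rintro q₁ q₂ q₃ q₄ q₅ q₆ q₇ q₈ q₉ rfl
      have e₇ : q₇ * (u ^ 3 * v * r₁) = q₇ * (u ^ 3 * v ^ 2) + C (4 / 9) * (q₇ * (u ^ 5 * v ^ 1))
        - C (13 / 9) * (q₇ * (u ^ 6 * v ^ 1)) := by
        simp only [r₁]; ring
      have e₈ : q₈ * (u * v ^ 2 * r₁) = q₈ * (u ^ 1 * v ^ 3) + C (4 / 9) * (q₈ * (u ^ 3 * v ^ 2))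
        - C (13 / 9) * (q₈ * (u ^ 4 * v ^ 2)) := by
        simp only [r₁]; ring
      have e₉ : q₉ * (v ^ 3 * h₁) = q₉ * (u ^ 0 * v ^ 4) + C (4 / 9) * (q₉ * (u ^ 2 * v ^ 3)) := by
        simp only [h₁]; ring
      rw [e₇, e₈, e₉]
      simp only [cfFive, cfSix, LinearMap.add_apply, LinearMap.sub_apply, LinearMap.smul_apply,
        smul_eq_mul, map_add, map_sub, cf_C_mul, cf_mul_monomial]
      refine ⟨?_, ?_, ?_, ?_, ?_, ?_⟩
      · intro a ha
        simp [ha]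
      · intro a ha
        interval_cases a <;> simp
      · intro a ha
        interval_cases a <;> simp
      · simp
      · norm_num
        ring
      · norm_num
        ring
    simp only [J₉, Ideal.mem_span_insert, Ideal.mem_span_singleton'] at hq
    obtain ⟨a₁, _, ⟨a₂, _, ⟨a₃, _, ⟨a₄, _, ⟨a₅, _, ⟨a₆, _, ⟨a₇, _, ⟨a₈, _, ⟨a₉, rfl⟩, rfl⟩, rfl⟩,
      rfl⟩, rfl⟩, rfl⟩, rfl⟩, rfl⟩, rfl⟩ := hq
    exact key a₁ a₂ a₃ a₄ a₅ a₆ a₇ a₈ a₉ (by ring)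
  · rintro ⟨h0, h1, h2, h3, h5, h6⟩
    have h := sub_normalForm_mem_J₉ q
    have hzero : normalForm q = 0 := by
      simp [normalForm, Finset.sum_range_succ, h0, h1, h2, h3, h5, h6]
    simpa [hzero] using h

/-- `64` times the coefficient of `u ^ n` in `phi ^ m`, for `m ≤ 6` and `n ≤ 16`. -/
def phiPowNum (m n : ℕ) : ℤ :=
  (([
    [64, 0, 0, 0, 0, 0, 0, 0, 0, 0, 0, 0, 0, 0, 0, 0, 0],
    [0, 0, -64, 64, -128, 256, -576, 1776, -5856, 20224, -69056, 232288, -801559, 2872109,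
     -10696666, 0, 0],
    [0, 0, 0, 0, 64, -128, 320, -768, 1920, -5728, 18592, -63872, 221376, -762400, 2660402,
     -9517976, 35103354],
    [0, 0, 0, 0, 0, 0, -64, 192, -576, 1600, -4416, 13392, -43520, 149328, -522720, 1832512,
     -6477105],
    [0, 0, 0, 0, 0, 0, 0, 0, 64, -256, 896, -2816, 8512, -26816, 88512, -305472, 1079232],
    [0, 0, 0, 0, 0, 0, 0, 0, 0, 0, -64, 320, -1280, 4480, -14720, 48624, -164640],
    [0, 0, 0, 0, 0, 0, 0, 0, 0, 0, 0, 0, 64, -384, 1728, -6656,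
     23616]] : List (List ℤ)).getD m []).getD n 0

theorem phiPowNum_zero : ∀ n < 17, phiPowNum 0 n = if n = 0 then 64 else 0 := by decide +kernel

theorem phiPowNum_succ : ∀ m < 6, ∀ n < 17, 64 * phiPowNum (m + 1) n =
    ∑ k ∈ Finset.range (n + 1), phiPowNum m k * phiPowNum 1 (n - k) := by
  decide +kernel

/-- The coefficient of `u ^ n` in `phi ^ m`, for `m ≤ 6` and `n ≤ 16`. -/
def phiPow (m n : ℕ) : ℚ := phiPowNum m n / 64

theorem phiPow_zero {n : ℕ} (hn : n < 17) : phiPow 0 n = if n = 0 then 1 else 0 := by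
  rw [phiPow, phiPowNum_zero n hn]
  split_ifs <;> norm_num

theorem phiPow_succ {m n : ℕ} (hm : m < 6) (hn : n < 17) :
    phiPow (m + 1) n = ∑ k ∈ Finset.range (n + 1), phiPow m k * phiPow 1 (n - k) := by
  have h : (64 * phiPowNum (m + 1) n : ℚ) =
      ∑ k ∈ Finset.range (n + 1), (phiPowNum m k * phiPowNum 1 (n - k) : ℚ) := by
    exact_mod_cast phiPowNum_succ m hm n hn
  simp only [phiPow, div_mul_div_comm, ← Finset.sum_div, ← h]
  ring

/-- The polynomial `phi`, in one variable. -/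
noncomputable def phiPoly : Polynomial ℂ :=
  ∑ n ∈ Finset.range 17, Polynomial.C (phiPow 1 n : ℂ) * Polynomial.X ^ n

theorem phi_eq_aeval : phi = Polynomial.aeval u phiPoly := by
  refine MvPolynomial.funext fun x => ?_
  norm_num [phi, phiPoly, Finset.sum_range_succ, phiPow, phiPowNum, algebraMap_eq]
  ring

theorem coeff_phiPoly {n : ℕ} (hn : n < 17) : phiPoly.coeff n = phiPow 1 n := by
  simp [phiPoly, Polynomial.finsetSum_coeff, Polynomial.coeff_X_pow, hn]

theorem coeff_phiPoly_pow {m n : ℕ} (hm : m ≤ 6) (hn : n < 17) :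
    (phiPoly ^ m).coeff n = phiPow m n := by
  induction m generalizing n with
  | zero => simp [Polynomial.coeff_one, phiPow_zero hn, apply_ite]
  | succ m ih =>
    rw [pow_succ, Polynomial.coeff_mul, phiPow_succ hm hn, Rat.cast_sum,
      Finset.Nat.sum_antidiagonal_eq_sum_range_succ_mk]
    refine Finset.sum_congr rfl fun k hk => ?_
    have hk := Finset.mem_range.1 hk
    rw [ih (by omega) (by omega), coeff_phiPoly (by omega), Rat.cast_mul]

theorem cf_aeval_mul (q : Polynomial ℂ) (a b i j : ℕ) :
    cf a b (Polynomial.aeval u q * (u ^ i * v ^ j)) =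
      if i ≤ a ∧ j = b then q.coeff (a - i) else 0 := by
  induction q using Polynomial.induction_on' with
  | add p q hp hq =>
    rw [map_add, add_mul, map_add, hp, hq]
    split_ifs <;> simp
  | monomial n r =>
    rw [Polynomial.aeval_monomial, algebraMap_eq, mul_assoc, ← mul_assoc (u ^ n), ← pow_add,
      cf_C_mul, cf_monomial, Polynomial.coeff_monomial]
    simp only [mul_ite, mul_one, mul_zero, ← ite_and]
    exact if_congr (by omega) rfl rfl

theorem cf_monomial_shift {a k i j : ℕ} (ha : a < 17) (hj : j ≤ 6) :
    cf a k (u ^ i * (v + phi) ^ j) =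
      if i ≤ a ∧ k ≤ j then (j.choose k * phiPow (j - k) (a - i) : ℂ) else 0 := by
  have h : u ^ i * (v + phi) ^ j = ∑ l ∈ Finset.range (j + 1), C (j.choose l : ℂ) *
      (Polynomial.aeval u (phiPoly ^ (j - l)) * (u ^ i * v ^ l)) := by
    rw [add_pow, Finset.mul_sum]
    refine Finset.sum_congr rfl fun l _ => ?_
    rw [map_pow, ← phi_eq_aeval, map_natCast]
    ring
  simp only [h, map_sum, cf_C_mul, cf_aeval_mul]
  by_cases hk : i ≤ a ∧ k ≤ j
  · rw [if_pos hk, Finset.sum_eq_single_of_mem k (by simp; omega), if_pos ⟨hk.1, rfl⟩,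
      coeff_phiPoly_pow (by omega) (by omega)]
    intro l _ hl
    simp [hl]
  · rw [if_neg hk]
    refine Finset.sum_eq_zero fun l hl => ?_
    rw [if_neg, mul_zero]
    rintro ⟨hi, rfl⟩
    exact hk ⟨hi, by simpa [Nat.lt_succ_iff] using hl⟩

theorem cf_σ_sum {a k : ℕ} (ha : a < 17) (c : ℕ → ℕ → ℂ) :
    cf a k (σ (∑ i ∈ Finset.range 7, ∑ j ∈ Finset.range (7 - i), C (c i j) * (u ^ i * v ^ j))) =
      ∑ i ∈ Finset.range 7, ∑ j ∈ Finset.range (7 - i), c i j *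
        if i ≤ a ∧ k ≤ j then (j.choose k * phiPow (j - k) (a - i) : ℂ) else 0 := by
  have hσ : ∀ g, MvPolynomial.aeval ![u, v + phi] g = σ g := fun _ => rfl
  rw [← hσ]
  simp only [map_sum]
  simp only [hσ, σ_apply_monomial, cf_C_mul]
  refine Finset.sum_congr rfl fun i _ => Finset.sum_congr rfl fun j hj => ?_
  rw [cf_monomial_shift ha (by have := Finset.mem_range.1 hj; omega)]

/-- `468` times the coefficient of `u ^ i * v ^ j` in `p`, for `i + j ≤ 6`. -/
def pNum (i j : ℕ) : ℤ :=
  (([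
    [0, 0, 0, 0, -729, -1458, 675],
    [0, 0, 0, 468, -522, -990],
    [0, 0, 0, -522, -1251],
    [0, 0, 1144, 154],
    [0, 0, 415],
    [0, 676],
    [0]] : List (List ℤ)).getD i []).getD j 0

theorem p_eq_sum : p = ∑ i ∈ Finset.range 7, ∑ j ∈ Finset.range (7 - i),
    C (pNum i j / 468 : ℂ) * (u ^ i * v ^ j) := by
  refine MvPolynomial.funext fun x => ?_
  simp [p, f₂, f₅, Finset.sum_range_succ, pNum]
  ring

/-- `468 * 64` times the coefficient of `u ^ a * v ^ k` in `σ p`, for `a ≤ 16`. -/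
def σpNum (a k : ℕ) : ℤ :=
  ∑ i ∈ Finset.range 7, ∑ j ∈ Finset.range (7 - i), pNum i j *
    if i ≤ a ∧ k ≤ j then j.choose k * phiPowNum (j - k) (a - i) else 0

theorem cf_σ_p {a k : ℕ} (ha : a < 17) : cf a k (σ p) = σpNum a k / (468 * 64) := by
  rw [p_eq_sum, cf_σ_sum ha, σpNum, Int.cast_sum, Finset.sum_div]
  refine Finset.sum_congr rfl fun i _ => ?_
  rw [Int.cast_sum, Finset.sum_div]
  refine Finset.sum_congr rfl fun j _ => ?_
  split_ifs
  · push_cast [phiPow]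
    ring
  · simp

theorem σ_p_mem_J₉ : σ p ∈ J₉ := by
  have h : ∀ a k, a < 17 → σpNum a k = 0 → cf a k (σ p) = 0 := fun a k ha h => by
    simp [cf_σ_p ha, h]
  have h0 : ∀ a < 17, σpNum a 0 = 0 := by decide +kernel
  have h1 : ∀ a < 5, σpNum a 1 = 0 := by decide +kernel
  have h2 : ∀ a < 3, σpNum a 2 = 0 := by decide +kernel
  have h3 : σpNum 0 3 = 0 := by decide +kernel
  have h5 : 81 * σpNum 5 1 - 36 * σpNum 3 2 + 16 * σpNum 1 3 = 0 := by decide +kernel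
  have h6 : 729 * σpNum 6 1 + 1053 * σpNum 3 2 - 324 * σpNum 4 2 - 936 * σpNum 1 3
      + 144 * σpNum 2 3 - 64 * σpNum 0 4 = 0 := by decide +kernel
  refine (mem_J₉_iff _).2 ⟨fun a ha => h a 0 ha (h0 a ha),
    fun a ha => h a 1 (by omega) (h1 a ha), fun a ha => h a 2 (by omega) (h2 a ha),
    h 0 3 (by omega) h3, ?_, ?_⟩
  · simp only [cfFive, LinearMap.add_apply, LinearMap.sub_apply, LinearMap.smul_apply,
      smul_eq_mul]
    simp only [cf_σ_p (show 1 < 17 by norm_num), cf_σ_p (show 3 < 17 by norm_num),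
      cf_σ_p (show 5 < 17 by norm_num)]
    have h5' := congrArg (Int.cast : ℤ → ℂ) h5
    push_cast at h5'
    linear_combination h5' / (81 * 468 * 64)
  · simp only [cfSix, LinearMap.add_apply, LinearMap.sub_apply, LinearMap.smul_apply,
      smul_eq_mul]
    simp only [cf_σ_p (show 0 < 17 by norm_num), cf_σ_p (show 1 < 17 by norm_num),
      cf_σ_p (show 2 < 17 by norm_num), cf_σ_p (show 3 < 17 by norm_num),
      cf_σ_p (show 4 < 17 by norm_num), cf_σ_p (show 6 < 17 by norm_num)]
    have h6' := congrArg (Int.cast : ℤ → ℂ) h6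
    push_cast at h6'
    linear_combination h6' / (729 * 468 * 64)

set_option maxHeartbeats 4000000 in
theorem eq_mul_pNum_of_σ_mem_J₉ {c : ℕ → ℕ → ℂ}
    (hc : σ (∑ i ∈ Finset.range 7, ∑ j ∈ Finset.range (7 - i), C (c i j) * (u ^ i * v ^ j)) ∈ J₉) :
    ∀ i < 7, ∀ j < 7 - i, c i j = 52 / 75 * c 0 6 * (pNum i j / 468) := by
  have h := fun a k (ha : a < 17) => cf_σ_sum (k := k) ha c
  simp only [mem_J₉_iff, cfFive, cfSix, LinearMap.add_apply, LinearMap.sub_apply,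
    LinearMap.smul_apply, smul_eq_mul] at hc
  obtain ⟨h0, h1, h2, h3, h5, h6⟩ := hc
  have e0 := h0 0 (by norm_num)
  have e1 := h0 1 (by norm_num)
  have e2 := h0 2 (by norm_num)
  have e3 := h0 3 (by norm_num)
  have e4 := h0 4 (by norm_num)
  have e5 := h0 5 (by norm_num)
  have e6 := h0 6 (by norm_num)
  have e7 := h0 7 (by norm_num)
  have e8 := h0 8 (by norm_num)
  have e9 := h0 9 (by norm_num)
  have e10 := h0 10 (by norm_num)
  have e11 := h0 11 (by norm_num)
  have e12 := h0 12 (by norm_num)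
  have e13 := h0 13 (by norm_num)
  have e14 := h0 14 (by norm_num)
  have e15 := h0 15 (by norm_num)
  have e16 := h0 16 (by norm_num)
  have d0 := h1 0 (by norm_num)
  have d1 := h1 1 (by norm_num)
  have d2 := h1 2 (by norm_num)
  have d3 := h1 3 (by norm_num)
  have d4 := h1 4 (by norm_num)
  have b0 := h2 0 (by norm_num)
  have b1 := h2 1 (by norm_num)
  have b2 := h2 2 (by norm_num)
  clear h0 h1 h2
  rw [h _ _ (by norm_num)] at e0 e1 e2 e3 e4 e5 e6 e7 e8 e9 e10 e11 e12 e13 e14 e15 e16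
  rw [h _ _ (by norm_num)] at d0 d1 d2 d3 d4 b0 b1 b2 h3
  iterate 3 rw [h _ _ (by norm_num)] at h5
  iterate 6 rw [h _ _ (by norm_num)] at h6
  clear h
  simp [Finset.sum_range_succ, phiPow, phiPowNum] at e0 e1 e2 e3 e4 e5 e6 e7
  simp [Finset.sum_range_succ, phiPow, phiPowNum] at e8 e9 e10 e11 e12 e13 e14 e15 e16
  simp [Finset.sum_range_succ, phiPow, phiPowNum, Nat.choose] at d0 d1 d2 d3 d4 b0 b1 b2 h3 h5 h6
  intro i hi j hj
  interval_cases i <;> simp only [Nat.reduceSub] at hj <;> interval_cases j <;>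
    norm_num [pNum]
  · linear_combination e0
  · linear_combination d0
  · linear_combination b0
  · linear_combination h3
  · linear_combination
        (136822 / 38025) * e7 + (1962 / 325) * e8 + (64 / 25) * e9 + (14 / 3) * e10
        + (2116 / 225) * e11 + (589 / 75) * e12 + (32 / 9) * e13 + (176 / 225) * e14
        + (-4 / 225) * e16 + (2167464589 / 54080) * d0 + (-522430243 / 50700) * d1
        + (-245403 / 1352) * d2 + (684369 / 13520) * d3 + (-294111 / 67600) * d4
        + (-111537 / 16900) * h5 + (-729 / 325) * h6 + (328293 / 4225) * b0 + (-3699 / 169) * b1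
        + (89577 / 16900) * b2 + (-10854 / 4225) * h3
  · linear_combination
        (5808238 / 1026675) * e7 + (509594 / 26325) * e8 + (10306 / 675) * e9 + (620 / 81) * e10
        + (97789 / 6075) * e11 + (36706 / 2025) * e12 + (2372 / 243) * e13 + (13904 / 6075) * e14
        + (-316 / 6075) * e16 + (86235272543 / 730080) * d0 + (-166378179463 / 5475600) * d1
        + (-753939 / 1352) * d2 + (2212893 / 13520) * d3 + (-930447 / 67600) * d4
        + (-111537 / 8450) * h5 + (-1458 / 325) * h6 + (825586 / 4225) * b0 + (-8919 / 169) * b1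
        + (191829 / 16900) * b2 + (-34383 / 4225) * h3
  · ring
  · linear_combination e1
  · linear_combination d1
  · linear_combination b1
  · linear_combination
        (-4246369 / 3080025) * e7 + (-245372 / 78975) * e8 + (-7228 / 2025) * e9
        + (-728 / 243) * e10 + (-71032 / 18225) * e11 + (-22828 / 6075) * e12 + (-1508 / 729) * e13
        + (-9152 / 18225) * e14 + (208 / 18225) * e16 + (-14436954851 / 547560) * d0
        + (110962170619 / 16426800) * d1 + (35709 / 338) * d2 + (-101637 / 3380) * d3
        + (26703 / 16900) * d4 + (15876 / 4225) * h5 + (243 / 325) * h6 + (-129256 / 4225) * b0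
        + (1155 / 169) * b1 + (-2671 / 4225) * b2 + (45629 / 12675) * h3
  · linear_combination
        (10136101 / 3080025) * e7 + (-46162 / 78975) * e8 + (-7463 / 2025) * e9 + (1352 / 243) * e10
        + (187228 / 18225) * e11 + (36262 / 6075) * e12 + (1412 / 729) * e13 + (7508 / 18225) * e14
        + (-232 / 18225) * e16 + (57881490701 / 2190240) * d0 + (-56331958763 / 8213400) * d1
        + (-569973 / 2704) * d2 + (277821 / 6760) * d3 + (-187299 / 33800) * d4
        + (-48033 / 8450) * h5 + (-972 / 325) * h6 + (1909171 / 16900) * b0 + (-5595 / 169) * b1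
        + (78893 / 8450) * b2 + (-49916 / 12675) * h3
  · linear_combination
        (2544409 / 616005) * e7 + (186482 / 15795) * e8 + (2848 / 405) * e9 + (700 / 243) * e10
        + (38122 / 3645) * e11 + (14758 / 1215) * e12 + (4852 / 729) * e13 + (5972 / 3645) * e14
        + (-148 / 3645) * e16 + (39936655709 / 438048) * d0 + (-38645987387 / 1642680) * d1
        + (-1254147 / 2704) * d2 + (324765 / 2704) * d3 + (-73467 / 13520) * d4
        + (-15957 / 1690) * h5 + (-243 / 65) * h6 + (606919 / 3380) * b0 + (-8102 / 169) * b1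
        + (36229 / 3380) * b2 + (-19109 / 2535) * h3
  · linear_combination e2 + d0
  · linear_combination d2 + 2 * b0
  · linear_combination b2 + 3 * h3
  · linear_combination
        (20288776 / 3080025) * e7 + (597338 / 78975) * e8 + (-6788 / 2025) * e9 + (812 / 243) * e10
        + (227728 / 18225) * e11 + (55162 / 6075) * e12 + (2276 / 729) * e13 + (10208 / 18225) * e14
        + (-232 / 18225) * e16 + (59247516011 / 2190240) * d0 + (-115332245851 / 16426800) * d1
        + (-104595 / 676) * d2 + (277821 / 6760) * d3 + (-187299 / 33800) * d4
        + (-48033 / 8450) * h5 + (-972 / 325) * h6 + (474124 / 4225) * b0 + (-6102 / 169) * b1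
        + (95793 / 8450) * b2 + (-11891 / 12675) * h3
  · linear_combination
        (20014558 / 3080025) * e7 + (1219379 / 78975) * e8 + (21646 / 2025) * e9
        + (2321 / 243) * e10 + (336199 / 18225) * e11 + (104071 / 6075) * e12 + (6044 / 729) * e13
        + (34964 / 18225) * e14 + (-856 / 18225) * e16 + (457063246291 / 4380480) * d0
        + (-110634560977 / 4106700) * d1 + (-1537697 / 2704) * d2 + (996453 / 6760) * d3
        + (-505467 / 33800) * d4 + (-207603 / 16900) * h5 + (-1701 / 325) * h6
        + (4067343 / 16900) * b0 + (-11322 / 169) * b1 + (138469 / 8450) * b2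
        + (-120503 / 12675) * h3
  · linear_combination e3 + (-1) * d0 + d1
  · linear_combination d3 + (-2) * b0 + 2 * b1
  · linear_combination
        (-112611043 / 27720225) * e7 + (-5398184 / 710775) * e8 + (-159016 / 18225) * e9
        + (-16016 / 2187) * e10 + (-1562704 / 164025) * e11 + (-502216 / 54675) * e12
        + (-33176 / 6561) * e13 + (-201344 / 164025) * e14 + (4576 / 164025) * e16
        + (-79379582873 / 1232010) * d0 + (1220123294609 / 73920600) * d1 + (132337 / 507) * d2
        + (-126563 / 1690) * d3 + (38487 / 8450) * d4 + (35883 / 4225) * h5 + (594 / 325) * h6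
        + (-2527732 / 38025) * b0 + (6715 / 507) * b1 + (-6112 / 38025) * b2
        + (898538 / 114075) * h3
  · linear_combination
        (76378337 / 27720225) * e7 + (-3815894 / 710775) * e8 + (-203656 / 18225) * e9
        + (2704 / 2187) * e10 + (1004636 / 164025) * e11 + (78194 / 54675) * e12
        + (-5924 / 6561) * e13 + (-51404 / 164025) * e14 + (616 / 164025) * e16
        + (-234181109753 / 19712160) * d0 + (54224175761 / 18480150) * d1 + (-394787 / 8112) * d2
        + (-31917 / 6760) * d3 + (-86757 / 33800) * d4 + (-8019 / 8450) * h5 + (-621 / 325) * h6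
        + (13245827 / 152100) * b0 + (-14549 / 507) * b1 + (745891 / 76050) * b2
        + (-189517 / 114075) * h3
  · linear_combination e4 + 2 * d0 + (-1) * d1 + d2 + b0
  · linear_combination d4 + 4 * b0 + (-2) * b1 + 2 * b2 + 3 * h3
  · linear_combination
        (14879914 / 5544045) * e7 + (162887 / 142155) * e8 + (-27332 / 3645) * e9
        + (-5810 / 2187) * e10 + (44572 / 32805) * e11 + (-4847 / 10935) * e12
        + (-8876 / 6561) * e13 + (-14608 / 32805) * e14 + (332 / 32805) * e16
        + (-194467650035 / 7884864) * d0 + (185114374301 / 29568240) * d1 + (330599 / 4056) * d2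
        + (-71035 / 2704) * d3 + (16277 / 13520) * d4 + (6399 / 3380) * h5 + (-27 / 65) * h6
        + (222271 / 7605) * b0 + (-6917 / 507) * b1 + (186769 / 30420) * b2 + (52651 / 22815) * h3
  · linear_combination e5 + (-4) * d0 + 2 * d1 + (-1) * d2 + d3 + (-2) * b0 + b1
  · linear_combination
        (-7854919 / 2132325) * e7 + (-245372 / 54675) * e8 + (-93964 / 18225) * e9
        + (-9464 / 2187) * e10 + (-923416 / 164025) * e11 + (-296764 / 54675) * e12
        + (-19604 / 6561) * e13 + (-118976 / 164025) * e14 + (2704 / 164025) * e16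
        + (-14419152671 / 379080) * d0 + (110788960219 / 11372400) * d1 + (12431 / 78) * d2
        + (-12173 / 260) * d3 + (5167 / 1300) * d4 + (1539 / 325) * h5 + (27 / 25) * h6
        + (-93256 / 2925) * b0 + (211 / 39) * b1 + (1379 / 2925) * b2 + (37529 / 8775) * h3
  · linear_combination
        e6 + 9 * d0 + (-4) * d1 + 2 * d2 + (-1) * d3 + d4 + 5 * b0 + (-2) * b1 + b2 + h3

/-- Case `k = 9` of Assertion 3(b): `Ker σ̄₉` is the one-dimensional space `ℂ·p`. -/
theorem ker_sigma_nine :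
    {g : MvPolynomial (Fin 2) ℂ | g.totalDegree ≤ 6 ∧ σ g ∈ J₉} =
      ↑(Submodule.span ℂ {p}) ∧
    Module.finrank ℂ ↥(Submodule.span ℂ ({p} : Set (MvPolynomial (Fin 2) ℂ))) = 1 := by
  refine ⟨?_, finrank_span_singleton fun h => ?_⟩
  · ext g
    simp only [Set.mem_ofPred_eq, SetLike.mem_coe, Submodule.mem_span_singleton]
    constructor
    · rintro ⟨hdeg, hg⟩
      have hsum := eq_sum_of_totalDegree_le hdeg
      rw [hsum] at hg
      refine ⟨52 / 75 * cf 0 6 g, ?_⟩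
      rw [smul_eq_C_mul, p_eq_sum, Finset.mul_sum, hsum]
      refine Finset.sum_congr rfl fun i hi => ?_
      rw [Finset.mul_sum]
      refine Finset.sum_congr rfl fun j hj => ?_
      rw [← mul_assoc, ← C_mul, ← hsum]
      rw [eq_mul_pNum_of_σ_mem_J₉ hg i (Finset.mem_range.1 hi) j (Finset.mem_range.1 hj)]
    · rintro ⟨r, rfl⟩
      refine ⟨(totalDegree_smul_le r p).trans ?_, ?_⟩
      · rw [p_eq_sum]
        exact totalDegree_sum_monomial_le _ 6
      · have hσ : σ (r • p) = C r * σ p := by simp [σ, smul_eq_C_mul, algebraMap_eq]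
        rw [hσ]
        exact J₉.mul_mem_left _ σ_p_mem_J₉
  · have h1 := congrArg (eval ![0, 1]) h
    norm_num [p, f₂, f₅, u, v] at h1
end
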